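/- Define α_n ∈ (ℤ/2)[t] for odd n > 0 by α₁ = 0, α₃ = t, α₅ = 0, α₇ = t⁵, and α_{n+8} = t⁸·α_n + t²·α_{n+2}. Write the code of t^n as (a,b). If a > 0, then α_n = [a−1,b] + (a sum of monomials with code strictly preceding (a−1,b)), where [a−1,b] denotes the monomial t^{1+2g(a−1)+4g(b)}. If a = 0, then α_n is a sum of monomials with code equal to or strictly preceding (0, b−1). -/

import Mathlib

open Polynomial

/-- `(c,d)` strictly precedes `(a,b)` in the Nicolas–Serre order. -/
def prec (c d a b : ℕ) : Prop := c + d < a + b ∨ (c + d = a + b ∧ d < b)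

/-- First component of the code. -/
def cC (m : ℕ) : ℕ := if h : m = 0 then 0 else m % 2 + 2 * cC (m / 4)
termination_by m
decreasing_by omega

/-- Second component of the code. -/
def cD (m : ℕ) : ℕ := if h : m = 0 then 0 else (m / 2) % 2 + 2 * cD (m / 4)
termination_by m
decreasing_by omega

lemma cC_eq (m : ℕ) : cC m = m % 2 + 2 * cC (m / 4) := by
  by_cases h : m = 0
  · subst h; simp [cC]
  · rw [cC, dif_neg h]

lemma cD_eq (m : ℕ) : cD m = (m / 2) % 2 + 2 * cD (m / 4) := by
  by_cases h : m = 0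
  · subst h; simp [cD]
  · rw [cD, dif_neg h]

lemma cC_four (y e : ℕ) (he : e < 4) : cC (4 * y + e) = e % 2 + 2 * cC y := by
  rw [cC_eq]; congr 1
  · omega
  · congr 2; omega

lemma cD_four (y e : ℕ) (he : e < 4) : cD (4 * y + e) = e / 2 + 2 * cD y := by
  rw [cD_eq]; congr 1
  · omega
  · congr 2; omega

lemma c_zero : cC 0 = 0 ∧ cD 0 = 0 := by constructor <;> simp [cC, cD]

/-- Splitting off the low `k` base-4 digits. -/
lemma c_split (k : ℕ) : ∀ x r, r < 4 ^ k →
    cC (x * 4 ^ k + r) = cC r + cC x * 2 ^ k ∧ cD (x * 4 ^ k + r) = cD r + cD x * 2 ^ k ∧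
    cC r < 2 ^ k ∧ cD r < 2 ^ k := by
  induction k with
  | zero =>
    intro x r hr
    have : r = 0 := by simpa using hr
    subst this
    simp [c_zero]
  | succ k ih =>
    intro x r hr
    have h4 : 4 ^ (k + 1) = 4 * 4 ^ k := by ring
    have h2 : 2 ^ (k + 1) = 2 * 2 ^ k := by ring
    obtain ⟨y, e, he, rfl⟩ : ∃ y e, e < 4 ∧ r = 4 * y + e :=
      ⟨r / 4, r % 4, by omega, by omega⟩
    obtain ⟨i1, i2, i3, i4⟩ := ih x y (by omega)
    have e1 : x * 4 ^ (k + 1) + (4 * y + e) = 4 * (x * 4 ^ k + y) + e := by rw [h4]; ring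
    rw [e1, cC_four _ _ he, cD_four _ _ he, cC_four _ _ he, cD_four _ _ he, i1, i2, h2]
    refine ⟨by ring, by ring, by omega, by omega⟩

lemma c_add_one (x : ℕ) : cC (x + 1) + cD (x + 1) ≤ cC x + cD x + 1 ∧
    (cC (x + 1) + cD (x + 1) = cC x + cD x + 1 →
      cD (x + 1) = cD x ∧ cC x % 2 = 0) := by
  induction x using Nat.strong_induction_on with
  | _ x ih =>
    obtain ⟨y, e, he, rfl⟩ : ∃ y e, e < 4 ∧ x = 4 * y + e :=
      ⟨x / 4, x % 4, by omega, by omega⟩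
    rw [cC_four _ _ he, cD_four _ _ he]
    by_cases h3 : e = 3
    · subst h3
      have e1 : 4 * y + 3 + 1 = 4 * (y + 1) + 0 := by ring
      rw [e1, cC_four _ _ (by omega), cD_four _ _ (by omega)]
      have := ih y (by omega)
      omega
    · rw [add_assoc, cC_four _ _ (by omega), cD_four _ _ (by omega)]
      omega

lemma c_add_one_even (x : ℕ) (h : cC x % 2 = 0) : cC (x + 1) = cC x + 1 ∧ cD (x + 1) = cD x := by
  obtain ⟨y, e, he, rfl⟩ : ∃ y e, e < 4 ∧ x = 4 * y + e :=
    ⟨x / 4, x % 4, by omega, by omega⟩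
  rw [cC_four _ _ he] at h
  rw [cC_four _ _ he, cD_four _ _ he, add_assoc, cC_four _ _ (by omega), cD_four _ _ (by omega)]
  omega

lemma c_add_two (x : ℕ) : cC (x + 2) + cD (x + 2) ≤ cC x + cD x + 1 ∧
    (cC (x + 2) + cD (x + 2) = cC x + cD x + 1 →
      cD (x + 2) ≤ cD x + 1 ∧ (cD x % 2 = 1 → cD (x + 2) < cD x + 1)) := by
  obtain ⟨y, e, he, rfl⟩ : ∃ y e, e < 4 ∧ x = 4 * y + e :=
    ⟨x / 4, x % 4, by omega, by omega⟩
  rw [cC_four _ _ he, cD_four _ _ he]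
  by_cases h3 : 2 ≤ e
  · have e1 : 4 * y + e + 2 = 4 * (y + 1) + (e - 2) := by omega
    rw [e1, cC_four _ _ (by omega), cD_four _ _ (by omega)]
    have := c_add_one y
    omega
  · rw [add_assoc, cC_four _ _ (by omega), cD_four _ _ (by omega)]
    omega

lemma exists_split (k m : ℕ) : ∃ x r, r < 4 ^ k ∧ m = x * 4 ^ k + r :=
  ⟨m / 4 ^ k, m % 4 ^ k, Nat.mod_lt _ (by positivity), by
    rw [mul_comm]; exact (Nat.div_add_mod _ _).symm⟩

lemma one_of_window {P r c : ℕ} (hr : r < P) (h1 : P ≤ r + c * P) (h2 : r + c * P < 2 * P) :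
    c = 1 := by
  have a : c < 2 := by by_contra hc; push Not at hc; nlinarith
  have b : c ≠ 0 := by rintro rfl; omega
  omega

lemma s_add_one (k m : ℕ) : cC (m + 4 ^ k) + cD (m + 4 ^ k) ≤ cC m + cD m + 2 ^ k ∧
    (cC (m + 4 ^ k) + cD (m + 4 ^ k) = cC m + cD m + 2 ^ k →
      cD (m + 4 ^ k) = cD m ∧ ¬ (2 ^ k ≤ cC m ∧ cC m < 2 * 2 ^ k)) := by
  obtain ⟨x, r, hr, rfl⟩ := exists_split k m
  have e1 : x * 4 ^ k + r + 4 ^ k = (x + 1) * 4 ^ k + r := by ring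
  obtain ⟨a1, a2, a3, a4⟩ := c_split k x r hr
  obtain ⟨b1, b2, -, -⟩ := c_split k (x + 1) r hr
  obtain ⟨h1, h2⟩ := c_add_one x
  rw [e1, a1, a2, b1, b2]
  have hP : 0 < 2 ^ k := by positivity
  generalize 2 ^ k = P at *
  refine ⟨by nlinarith, fun h => ?_⟩
  have h' : cC (x + 1) + cD (x + 1) = cC x + cD x + 1 := by
    apply Nat.eq_of_mul_eq_mul_right hP; linarith
  obtain ⟨h3, h4⟩ := h2 h'
  refine ⟨by rw [h3], fun ⟨h5, h6⟩ => ?_⟩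
  have := one_of_window a3 h5 h6
  omega

lemma s_add_one_lt (k m : ℕ) (h : cC m < 2 ^ k) :
    cC (m + 4 ^ k) = cC m + 2 ^ k ∧ cD (m + 4 ^ k) = cD m := by
  obtain ⟨x, r, hr, rfl⟩ := exists_split k m
  have e1 : x * 4 ^ k + r + 4 ^ k = (x + 1) * 4 ^ k + r := by ring
  obtain ⟨a1, a2, a3, a4⟩ := c_split k x r hr
  obtain ⟨b1, b2, -, -⟩ := c_split k (x + 1) r hr
  have hx : cC x = 0 := by
    by_contra hc
    have : 1 ≤ cC x := by omega
    rw [a1] at h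
    nlinarith
  obtain ⟨h1, h2⟩ := c_add_one_even x (by omega)
  rw [e1, a1, a2, b1, b2, h1, h2]
  exact ⟨by ring, rfl⟩

lemma s_add_two (k m : ℕ) : cC (m + 2 * 4 ^ k) + cD (m + 2 * 4 ^ k) ≤ cC m + cD m + 2 ^ k ∧
    (cC (m + 2 * 4 ^ k) + cD (m + 2 * 4 ^ k) = cC m + cD m + 2 ^ k →
      cD (m + 2 * 4 ^ k) ≤ cD m + 2 ^ k ∧
      (2 ^ k ≤ cD m → cD m < 2 * 2 ^ k → cD (m + 2 * 4 ^ k) < cD m + 2 ^ k)) := by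
  obtain ⟨x, r, hr, rfl⟩ := exists_split k m
  have e1 : x * 4 ^ k + r + 2 * 4 ^ k = (x + 2) * 4 ^ k + r := by ring
  obtain ⟨a1, a2, a3, a4⟩ := c_split k x r hr
  obtain ⟨b1, b2, -, -⟩ := c_split k (x + 2) r hr
  obtain ⟨h1, h2⟩ := c_add_two x
  rw [e1, a1, a2, b1, b2]
  have hP : 0 < 2 ^ k := by positivity
  generalize 2 ^ k = P at *
  refine ⟨by nlinarith, fun h => ?_⟩
  have h' : cC (x + 2) + cD (x + 2) = cC x + cD x + 1 := by
    apply Nat.eq_of_mul_eq_mul_right hP; linarith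
  obtain ⟨h3, h4⟩ := h2 h'
  refine ⟨by nlinarith, fun h5 h6 => ?_⟩
  have := one_of_window a4 h5 h6
  have := h4 (by omega)
  nlinarith

/-- The inductive statement. -/
def Good (f : ℕ → ℕ → ZMod 2) (j : ℕ) : Prop :=
  (∀ i, f j i ≠ 0 → i < j ∧ cC i + cD i < cC j + cD j ∧
    (cC i + cD i + 1 = cC j + cD j → cD i ≤ cD j)) ∧
  (0 < cC j → ∃ i, f j i ≠ 0 ∧ cC i + 1 = cC j ∧ cD i = cD j)

lemma c_small : (cC 1 = 1 ∧ cD 1 = 0) ∧ (cC 2 = 0 ∧ cD 2 = 1) ∧ (cC 3 = 1 ∧ cD 3 = 1) := by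
  have h := c_zero
  have a := fun e he => cC_four 0 e he
  have b := fun e he => cD_four 0 e he
  have a1 := a 1 (by omega)
  have a2 := a 2 (by omega)
  have a3 := a 3 (by omega)
  have b1 := b 1 (by omega)
  have b2 := b 2 (by omega)
  have b3 := b 3 (by omega)
  simp [h.1, h.2] at a1 a2 a3 b1 b2 b3
  omega

lemma or_of_add {a b : ZMod 2} (h : a + b ≠ 0) : a ≠ 0 ∨ b ≠ 0 := by
  by_contra hc; push Not at hc; simp [hc.1, hc.2] at h

/-- codes of `x*4^k + r` for small x -/
lemma c_digits (k r : ℕ) (hr : r < 4 ^ k) :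
    (cC (r + 1 * 4 ^ k) = cC r + 2 ^ k ∧ cD (r + 1 * 4 ^ k) = cD r) ∧
    (cC (r + 2 * 4 ^ k) = cC r ∧ cD (r + 2 * 4 ^ k) = cD r + 2 ^ k) ∧
    (cC (r + 3 * 4 ^ k) = cC r + 2 ^ k ∧ cD (r + 3 * 4 ^ k) = cD r + 2 ^ k) := by
  have h := c_small
  have a1 := c_split k 1 r hr
  have a2 := c_split k 2 r hr
  have a3 := c_split k 3 r hr
  rw [add_comm] at a1 a2 a3
  obtain ⟨⟨h1, h2⟩, ⟨h3, h4⟩, ⟨h5, h6⟩⟩ := h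
  rw [h1, h2] at a1
  rw [h3, h4] at a2
  rw [h5, h6] at a3
  omega

lemma comb (f : ℕ → ℕ → ZMod 2) (j : ℕ) (u v : ℕ → ZMod 2) (N N' : ℕ)
    (h : ∀ i, f j i = (if N ≤ i then u (i - N) else 0) + (if N' ≤ i then v (i - N') else 0))
    (hu : ∀ i, u i ≠ 0 → i + N < j ∧ cC (i + N) + cD (i + N) < cC j + cD j ∧
      (cC (i + N) + cD (i + N) + 1 = cC j + cD j → cD (i + N) ≤ cD j))
    (hu' : 0 < cC j → ∃ i, u i ≠ 0 ∧ cC (i + N) + 1 = cC j ∧ cD (i + N) = cD j)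
    (hv : ∀ i, v i ≠ 0 → i + N' < j ∧ cC (i + N') + cD (i + N') < cC j + cD j ∧
      (cC (i + N') + cD (i + N') + 1 = cC j + cD j → cD (i + N') < cD j)) : Good f j := by
  constructor
  · intro i hi
    rw [h] at hi
    rcases or_of_add hi with h1 | h1
    · split_ifs at h1 with hN
      · have := hu _ h1
        rwa [Nat.sub_add_cancel hN] at this
      · exact absurd rfl h1
    · split_ifs at h1 with hN
      · have := hv _ h1
        rw [Nat.sub_add_cancel hN] at this
        exact ⟨this.1, this.2.1, fun h => (this.2.2 h).le⟩
      · exact absurd rfl h1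
  · intro hj
    obtain ⟨i, h1, h2, h3⟩ := hu' hj
    refine ⟨i + N, ?_, h2, h3⟩
    rw [h, if_pos (by omega), Nat.add_sub_cancel]
    have : (if N' ≤ i + N then v (i + N - N') else 0) = 0 := by
      split_ifs with hN
      · by_contra hc
        have := hv _ hc
        rw [Nat.sub_add_cancel hN] at this
        omega
      · rfl
    rw [this, add_zero]
    exact h1

lemma block1 (f : ℕ → ℕ → ZMod 2) (q P N r n j x y : ℕ) (hq : 0 < q) (hx : x < P) (hy : y < P)
    (hN : N = 4 * q) (hr : r < N) (hn : n = r + q) (hj : j = r + N)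
    (cj1 : cC j = cC r + 2 * P) (cj2 : cD j = cD r)
    (cr : (cC r = x + 0 * P ∧ cD r = y + 0 * P ∧ cC n = x + 1 * P ∧ cD n = y + 0 * P) ∨
      (cC r = x + 1 * P ∧ cD r = y + 0 * P ∧ cC n = x + 0 * P ∧ cD n = y + 1 * P) ∨
      (cC r = x + 0 * P ∧ cD r = y + 1 * P ∧ cC n = x + 1 * P ∧ cD n = y + 1 * P) ∨
      (cC r = x + 1 * P ∧ cD r = y + 1 * P ∧ cC n = x + 2 * P ∧ cD n = y + 0 * P))
    (G1 : Good f r) (G2 : Good f n)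
    (D : ∀ i, i < N → cC (i + N) = cC i + 2 * P ∧ cD (i + N) = cD i)
    (T1 : ∀ i, cC (i + q) + cD (i + q) ≤ cC i + cD i + P ∧
      (cC (i + q) + cD (i + q) = cC i + cD i + P →
        cD (i + q) = cD i ∧ ¬ (P ≤ cC i ∧ cC i < 2 * P)))
    (T1' : ∀ i, cC i < P → cC (i + q) = cC i + P ∧ cD (i + q) = cD i)
    (hrec : ∀ i, f j i = (if N ≤ i then f r (i - N) else 0) + (if q ≤ i then f n (i - q) else 0)) :
    Good f j := by
  obtain ⟨g1, g2⟩ := G1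
  obtain ⟨g3, g4⟩ := G2
  by_cases hc : 0 < cC r
  · refine comb f _ (f r) (f n) N q hrec ?_ ?_ ?_
    · intro i hi
      obtain ⟨a1, a2, a3⟩ := g1 i hi
      obtain ⟨b1, b2⟩ := D i (by omega)
      clear cr
      refine ⟨by omega, by omega, by omega⟩
    · intro _
      obtain ⟨i, b1, b2, b3⟩ := g2 hc
      have a1 := (g1 i b1).1
      obtain ⟨c1, c2⟩ := D i (by omega)
      clear cr
      exact ⟨i, b1, by omega, by omega⟩
    · intro i hi
      obtain ⟨a1, a2, a3⟩ := g3 i hi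
      obtain ⟨b1, b2⟩ := T1 i
      generalize cC (i + q) = u at *
      generalize cD (i + q) = v at *
      rcases cr with ⟨r1, r2, r3, r4⟩ | ⟨r1, r2, r3, r4⟩ | ⟨r1, r2, r3, r4⟩ | ⟨r1, r2, r3, r4⟩ <;>
        refine ⟨by omega, by omega, by omega⟩
  · refine comb f _ (f n) (f r) q N (fun i => by rw [hrec, add_comm]) ?_ ?_ ?_
    · intro i hi
      obtain ⟨a1, a2, a3⟩ := g3 i hi
      obtain ⟨b1, b2⟩ := T1 i
      generalize cC (i + q) = u at *
      generalize cD (i + q) = v at *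
      rcases cr with ⟨r1, r2, r3, r4⟩ | ⟨r1, r2, r3, r4⟩ | ⟨r1, r2, r3, r4⟩ | ⟨r1, r2, r3, r4⟩ <;>
        refine ⟨by omega, by omega, by omega⟩
    · intro _
      obtain ⟨i, b1, b2, b3⟩ := g4 (by omega)
      clear g2 g4
      obtain ⟨c1, c2⟩ := T1' i (by omega)
      exact ⟨i, b1, by omega, by omega⟩
    · intro i hi
      obtain ⟨a1, a2, a3⟩ := g1 i hi
      obtain ⟨b1, b2⟩ := D i (by omega)
      clear cr
      refine ⟨by omega, by omega, by omega⟩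

lemma block2 (f : ℕ → ℕ → ZMod 2) (q P N r n j x y : ℕ) (hq : 0 < q) (hx : x < P) (hy : y < P)
    (hN : N = 4 * q) (hr : r < 2 * q) (hn : n = r + q) (hj : j = r + N)
    (cj1 : cC j = cC r) (cj2 : cD j = cD r + 2 * P)
    (cr : (cC r = x + 0 * P ∧ cD r = y + 0 * P ∧ cC n = x + 0 * P ∧ cD n = y + 1 * P) ∨
      (cC r = x + 1 * P ∧ cD r = y + 0 * P ∧ cC n = x + 1 * P ∧ cD n = y + 1 * P) ∨
      (cC r = x + 0 * P ∧ cD r = y + 1 * P ∧ cC n = x + 2 * P ∧ cD n = y + 0 * P) ∨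
      (cC r = x + 1 * P ∧ cD r = y + 1 * P ∧ cC n = x + 3 * P ∧ cD n = y + 0 * P))
    (G1 : Good f r) (G2 : Good f n)
    (D : ∀ i, i < 2 * q → cC (i + N) = cC i ∧ cD (i + N) = cD i + 2 * P)
    (T2 : ∀ i, cC (i + q) + cD (i + q) ≤ cC i + cD i + P ∧
      (cC (i + q) + cD (i + q) = cC i + cD i + P → cD (i + q) ≤ cD i + P ∧
        (P ≤ cD i → cD i < 2 * P → cD (i + q) < cD i + P)))
    (hrec : ∀ i, f j i = (if N ≤ i then f r (i - N) else 0) + (if q ≤ i then f n (i - q) else 0)) :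
    Good f j := by
  obtain ⟨g1, g2⟩ := G1
  obtain ⟨g3, g4⟩ := G2
  refine comb f _ (f r) (f n) N q hrec ?_ ?_ ?_
  · intro i hi
    obtain ⟨a1, a2, a3⟩ := g1 i hi
    obtain ⟨b1, b2⟩ := D i (by omega)
    clear cr
    refine ⟨by omega, by omega, by omega⟩
  · intro _
    obtain ⟨i, b1, b2, b3⟩ := g2 (by omega)
    have a1 := (g1 i b1).1
    obtain ⟨c1, c2⟩ := D i (by omega)
    clear cr
    exact ⟨i, b1, by omega, by omega⟩
  · intro i hi
    obtain ⟨a1, a2, a3⟩ := g3 i hi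
    obtain ⟨b1, b2⟩ := T2 i
    generalize cC (i + q) = u at *
    generalize cD (i + q) = v at *
    rcases cr with ⟨r1, r2, r3, r4⟩ | ⟨r1, r2, r3, r4⟩ | ⟨r1, r2, r3, r4⟩ | ⟨r1, r2, r3, r4⟩ <;>
      refine ⟨by omega, by omega, by omega⟩

lemma block3 (f : ℕ → ℕ → ZMod 2) (q P N r p n j x y : ℕ) (hq : 0 < q) (hx : x < P) (hy : y < P)
    (hN : N = 4 * q) (hr : p < N) (hn : n = p + q) (hj : j = p + N)
    (cp1 : cC p = cC r + 2 * P) (cp2 : cD p = cD r)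
    (cj1 : cC j = cC r + 2 * P) (cj2 : cD j = cD r + 2 * P)
    (cr : (cC r = x + 0 * P ∧ cD r = y + 0 * P ∧ cC n = x + 2 * P ∧ cD n = y + 1 * P) ∨
      (cC r = x + 1 * P ∧ cD r = y + 0 * P ∧ cC n = x + 3 * P ∧ cD n = y + 1 * P) ∨
      (cC r = x + 0 * P ∧ cD r = y + 1 * P ∧ cC n = x + 0 * P ∧ cD n = y + 2 * P) ∨
      (cC r = x + 1 * P ∧ cD r = y + 1 * P ∧ cC n = x + 1 * P ∧ cD n = y + 2 * P))
    (G1 : Good f p) (G2 : Good f n)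
    (D : ∀ i, i < N → cC (i + N) = cC i ∧ cD (i + N) = cD i + 2 * P)
    (T2 : ∀ i, cC (i + q) + cD (i + q) ≤ cC i + cD i + P ∧
      (cC (i + q) + cD (i + q) = cC i + cD i + P → cD (i + q) ≤ cD i + P ∧
        (P ≤ cD i → cD i < 2 * P → cD (i + q) < cD i + P)))
    (hrec : ∀ i, f j i = (if N ≤ i then f p (i - N) else 0) + (if q ≤ i then f n (i - q) else 0)) :
    Good f j := by
  obtain ⟨g1, g2⟩ := G1
  obtain ⟨g3, g4⟩ := G2
  refine comb f _ (f p) (f n) N q hrec ?_ ?_ ?_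
  · intro i hi
    obtain ⟨a1, a2, a3⟩ := g1 i hi
    obtain ⟨b1, b2⟩ := D i (by omega)
    clear cr
    refine ⟨by omega, by omega, by omega⟩
  · intro _
    obtain ⟨i, b1, b2, b3⟩ := g2 (by omega)
    have a1 := (g1 i b1).1
    obtain ⟨c1, c2⟩ := D i (by omega)
    clear cr
    exact ⟨i, b1, by omega, by omega⟩
  · intro i hi
    obtain ⟨a1, a2, a3⟩ := g3 i hi
    obtain ⟨b1, b2⟩ := T2 i
    generalize cC (i + q) = u at *
    generalize cD (i + q) = v at *
    rcases cr with ⟨r1, r2, r3, r4⟩ | ⟨r1, r2, r3, r4⟩ | ⟨r1, r2, r3, r4⟩ | ⟨r1, r2, r3, r4⟩ <;>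
      refine ⟨by omega, by omega, by omega⟩

set_option maxHeartbeats 1000000 in
lemma good_all (f : ℕ → ℕ → ZMod 2)
    (f0 : ∀ i, f 0 i = 0) (f1 : ∀ i, f 1 i ≠ 0 ↔ i = 0) (f2 : ∀ i, f 2 i = 0)
    (f3 : ∀ i, f 3 i ≠ 0 ↔ i = 2)
    (hf : ∀ k j i, f (j + 4 * 2 ^ k) i = (if 4 * 2 ^ k ≤ i then f j (i - 4 * 2 ^ k) else 0)
      + (if 2 ^ k ≤ i then f (j + 2 ^ k) (i - 2 ^ k) else 0)) (j : ℕ) : Good f j := by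
  obtain ⟨⟨s1, s2⟩, ⟨s3, s4⟩, ⟨s5, s6⟩⟩ := c_small
  obtain ⟨z1, z2⟩ := c_zero
  induction j using Nat.strong_induction_on with
  | _ j ih =>
  by_cases hj : j < 4
  · interval_cases j
    · refine ⟨fun i hi => absurd (f0 i) hi, fun h => by omega⟩
    · refine ⟨fun i hi => ?_, fun h => ⟨0, (f1 0).2 rfl, by omega, by omega⟩⟩
      obtain rfl := (f1 i).1 hi
      omega
    · refine ⟨fun i hi => absurd (f2 i) hi, fun h => by omega⟩
    · refine ⟨fun i hi => ?_, fun h => ⟨2, (f3 2).2 rfl, by omega, by omega⟩⟩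
      obtain rfl := (f3 i).1 hi
      omega
  · push Not at hj
    obtain ⟨k, hk1, hk2⟩ : ∃ k, 4 * 4 ^ k ≤ j ∧ j < 16 * 4 ^ k := by
      have h1 : Nat.log 4 j ≠ 0 := by
        have := Nat.log_pos (b := 4) (by omega) hj; omega
      obtain ⟨k, hk⟩ := Nat.exists_eq_succ_of_ne_zero h1
      refine ⟨k, ?_, ?_⟩
      · have := Nat.pow_log_le_self 4 (x := j) (by omega)
        rw [hk, Nat.succ_eq_add_one, pow_succ] at this; omega
      · have := Nat.lt_pow_succ_log_self (b := 4) (by omega) j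
        rw [hk, Nat.succ_eq_add_one, pow_succ, pow_succ] at this; omega
    have p1 : 2 ^ (2 * k) = 4 ^ k := by rw [pow_mul]; norm_num
    have p2 : 2 ^ (2 * k + 1) = 2 * 4 ^ k := by rw [pow_succ, p1]; ring
    have hA := hf (2 * k)
    have hB := hf (2 * k + 1)
    rw [p1] at hA
    rw [p2] at hB
    have hq : 0 < 4 ^ k := by positivity
    have hP : 0 < 2 ^ k := by positivity
    have T1 := s_add_one k
    have T1' := s_add_one_lt k
    have T2 := s_add_two k
    have D1 := c_digits k
    have D0 : ∀ r, r < 4 ^ k → cC r < 2 ^ k ∧ cD r < 2 ^ k := fun r hr => (c_split k 0 r hr).2.2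
    have D2 := c_digits (k + 1)
    have e4 : 4 ^ (k + 1) = 4 * 4 ^ k := by ring
    have e2 : 2 ^ (k + 1) = 2 * 2 ^ k := by ring
    rw [e4, e2] at D2
    generalize 4 ^ k = q at *
    generalize 2 ^ k = P at *
    clear hf p1 p2 e4 e2
    have hr0 : ∃ s r, r < 4 * q ∧ j = r + s * (4 * q) ∧ (s = 1 ∨ s = 2 ∨ s = 3) := by
      by_cases h1 : j < 8 * q
      · exact ⟨1, j - 4 * q, by omega, by omega, by omega⟩
      by_cases h2 : j < 12 * q
      · exact ⟨2, j - 8 * q, by omega, by omega, by omega⟩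
      · exact ⟨3, j - 12 * q, by omega, by omega, by omega⟩
    obtain ⟨s, r, hr, rfl, hs⟩ := hr0
    have he0 : ∃ e r', r' < q ∧ r = r' + e * q ∧ (e = 0 ∨ e = 1 ∨ e = 2 ∨ e = 3) := by
      by_cases h1 : r < q
      · exact ⟨0, r, by omega, by omega, by omega⟩
      by_cases h1 : r < 2 * q
      · exact ⟨1, r - q, by omega, by omega, by omega⟩
      by_cases h2 : r < 3 * q
      · exact ⟨2, r - 2 * q, by omega, by omega, by omega⟩
      · exact ⟨3, r - 3 * q, by omega, by omega, by omega⟩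
    obtain ⟨e, t, ht, hrt, he⟩ := he0
    have cj := D2 r hr
    have ct := D1 t ht
    have ct4 := D2 t (by omega)
    have ct5 := D2 (t + q) (by omega)
    have ct0 := D0 t ht
    have cr :
        ((cC (r) = cC t + 0 * P ∧ cD (r) = cD t + 0 * P) ∧
          (cC (r + q) = cC t + 1 * P ∧ cD (r + q) = cD t + 0 * P) ∧
          (cC (r + 2 * q) = cC t + 0 * P ∧ cD (r + 2 * q) = cD t + 1 * P) ∧
          (cC (r + 6 * q) = cC t + 2 * P ∧ cD (r + 6 * q) = cD t + 1 * P)) ∨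
        ((cC (r) = cC t + 1 * P ∧ cD (r) = cD t + 0 * P) ∧
          (cC (r + q) = cC t + 0 * P ∧ cD (r + q) = cD t + 1 * P) ∧
          (cC (r + 2 * q) = cC t + 1 * P ∧ cD (r + 2 * q) = cD t + 1 * P) ∧
          (cC (r + 6 * q) = cC t + 3 * P ∧ cD (r + 6 * q) = cD t + 1 * P)) ∨
        ((cC (r) = cC t + 0 * P ∧ cD (r) = cD t + 1 * P) ∧
          (cC (r + q) = cC t + 1 * P ∧ cD (r + q) = cD t + 1 * P) ∧
          (cC (r + 2 * q) = cC t + 2 * P ∧ cD (r + 2 * q) = cD t + 0 * P) ∧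
          (cC (r + 6 * q) = cC t + 0 * P ∧ cD (r + 6 * q) = cD t + 2 * P)) ∨
        ((cC (r) = cC t + 1 * P ∧ cD (r) = cD t + 1 * P) ∧
          (cC (r + q) = cC t + 2 * P ∧ cD (r + q) = cD t + 0 * P) ∧
          (cC (r + 2 * q) = cC t + 3 * P ∧ cD (r + 2 * q) = cD t + 0 * P) ∧
          (cC (r + 6 * q) = cC t + 1 * P ∧ cD (r + 6 * q) = cD t + 2 * P)) := by
      have ct6 := D2 (t + 2 * q) (by omega)
      have ct7 := D2 (t + 3 * q) (by omega)
      rw [show t + 1 * q = t + q by ring] at ct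
      clear cj
      rcases he with rfl | rfl | rfl | rfl <;> subst hrt
      · left
        rw [show t + 0 * q + 6 * q = t + 2 * q + 1 * (4 * q) by ring,
          show t + 0 * q + 2 * q = t + 2 * q by ring,
          show t + 0 * q + q = t + q by ring,
          show t + 0 * q = t by ring]
        refine ⟨⟨?_, ?_⟩, ⟨?_, ?_⟩, ⟨?_, ?_⟩, ?_, ?_⟩ <;> (try simp only [ct, ct4, ct5, ct6, ct7]) <;> ring
      · right; left
        rw [show t + 1 * q + 6 * q = t + 3 * q + 1 * (4 * q) by ring,
          show t + 1 * q + 2 * q = t + 3 * q by ring,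
          show t + 1 * q + q = t + 2 * q by ring,
          show t + 1 * q = t + q by ring]
        refine ⟨⟨?_, ?_⟩, ⟨?_, ?_⟩, ⟨?_, ?_⟩, ?_, ?_⟩ <;> (try simp only [ct, ct4, ct5, ct6, ct7]) <;> ring
      · right; right; left
        rw [show t + 2 * q + 6 * q = t + 2 * (4 * q) by ring,
          show t + 2 * q + 2 * q = t + 1 * (4 * q) by ring,
          show t + 2 * q + q = t + 3 * q by ring]
        refine ⟨⟨?_, ?_⟩, ⟨?_, ?_⟩, ⟨?_, ?_⟩, ?_, ?_⟩ <;> (try simp only [ct, ct4, ct5, ct6, ct7]) <;> ring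
      · right; right; right
        rw [show t + 3 * q + 6 * q = t + q + 2 * (4 * q) by ring,
          show t + 3 * q + 2 * q = t + q + 1 * (4 * q) by ring,
          show t + 3 * q + q = t + 1 * (4 * q) by ring]
        refine ⟨⟨?_, ?_⟩, ⟨?_, ?_⟩, ⟨?_, ?_⟩, ?_, ?_⟩ <;> (try simp only [ct, ct4, ct5, ct6, ct7]) <;> ring
    clear D1 D0 ct ct4 ct5 hrt he f0 f1 f2 f3 s1 s2 s3 s4 s5 s6 z1 z2 hk1 hk2 hj
    obtain ⟨⟨cj1, cj2⟩, ⟨cj3, cj4⟩, cj5, cj6⟩ := cj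
    obtain ⟨ct1, ct2⟩ := ct0
    rcases hs with rfl | rfl | rfl
    · refine block1 f q P (4 * q) r (r + q) _ (cC t) (cD t) hq ct1 ct2 rfl hr rfl (by ring)
        cj1 cj2 ?_ (ih _ (by omega)) (ih _ (by omega)) ?_ T1 T1' ?_
      · rcases cr with h | h | h | h
        · exact Or.inl ⟨h.1.1, h.1.2, h.2.1.1, h.2.1.2⟩
        · exact Or.inr (Or.inl ⟨h.1.1, h.1.2, h.2.1.1, h.2.1.2⟩)
        · exact Or.inr (Or.inr (Or.inl ⟨h.1.1, h.1.2, h.2.1.1, h.2.1.2⟩))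
        · exact Or.inr (Or.inr (Or.inr ⟨h.1.1, h.1.2, h.2.1.1, h.2.1.2⟩))
      · intro i hi
        have := (D2 i hi).1
        rwa [one_mul] at this
      · intro i
        rw [one_mul]
        exact hA r i
    · refine block2 f (2 * q) P (4 * (2 * q)) r (r + 2 * q) _ (cC t) (cD t) (by omega) ct1 ct2 rfl
        (by omega) rfl (by ring) cj3 cj4 ?_ (ih _ (by omega)) (ih _ (by omega)) ?_ T2 ?_
      · rcases cr with h | h | h | h
        · exact Or.inl ⟨h.1.1, h.1.2, h.2.2.1.1, h.2.2.1.2⟩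
        · exact Or.inr (Or.inl ⟨h.1.1, h.1.2, h.2.2.1.1, h.2.2.1.2⟩)
        · exact Or.inr (Or.inr (Or.inl ⟨h.1.1, h.1.2, h.2.2.1.1, h.2.2.1.2⟩))
        · exact Or.inr (Or.inr (Or.inr ⟨h.1.1, h.1.2, h.2.2.1.1, h.2.2.1.2⟩))
      · intro i hi
        rw [show 4 * (2 * q) = 2 * (4 * q) by ring]
        exact (D2 i (by rw [show 4 * q = 2 * (2 * q) by ring]; exact hi)).2.1
      · intro i
        rw [show 2 * (4 * q) = 4 * (2 * q) by ring]
        exact hB r i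
    · refine block3 f (2 * q) P (4 * (2 * q)) r (r + 1 * (4 * q)) (r + 6 * q) _ (cC t) (cD t)
        (by omega) ct1 ct2 rfl (by omega) (by ring) (by ring) cj1 cj2 cj5 cj6 ?_
        (ih _ (by omega)) (ih _ (by omega)) ?_ T2 ?_
      · rcases cr with h | h | h | h
        · exact Or.inl ⟨h.1.1, h.1.2, h.2.2.2.1, h.2.2.2.2⟩
        · exact Or.inr (Or.inl ⟨h.1.1, h.1.2, h.2.2.2.1, h.2.2.2.2⟩)
        · exact Or.inr (Or.inr (Or.inl ⟨h.1.1, h.1.2, h.2.2.2.1, h.2.2.2.2⟩))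
        · exact Or.inr (Or.inr (Or.inr ⟨h.1.1, h.1.2, h.2.2.2.1, h.2.2.2.2⟩))
      · intro i hi
        by_cases h4 : i < 4 * q
        · rw [show 4 * (2 * q) = 2 * (4 * q) by ring]
          exact (D2 i h4).2.1
        · obtain ⟨i', hi', rfl⟩ : ∃ i', i' < 4 * q ∧ i = i' + 1 * (4 * q) :=
            ⟨i - 4 * q, by omega, by omega⟩
          obtain ⟨⟨d1, d2⟩, -, d5, d6⟩ := D2 i' hi'
          rw [show i' + 1 * (4 * q) + 4 * (2 * q) = i' + 3 * (4 * q) by ring, d1, d2, d5, d6]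
          exact ⟨rfl, rfl⟩
      · intro i
        rw [show r + 3 * (4 * q) = r + 1 * (4 * q) + 4 * (2 * q) by ring, hB,
          show r + 1 * (4 * q) + 2 * q = r + 6 * q by ring]

lemma g_div (g : ℕ → ℕ) (hge : ∀ n, g (2 * n) = 4 * g n)
    (hgo : ∀ n, g (2 * n + 1) = g (2 * n) + 1) (n e : ℕ) (he : e < 2) :
    g (e + 2 * n) = 4 * g n + e := by
  rw [add_comm]
  have : e = 0 ∨ e = 1 := by omega
  rcases this with rfl | rfl
  · simpa using hge n
  · rw [hgo, hge]

lemma g_code (g : ℕ → ℕ) (hg0 : g 0 = 0) (hge : ∀ n, g (2 * n) = 4 * g n)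
    (hgo : ∀ n, g (2 * n + 1) = g (2 * n) + 1) (m : ℕ) :
    m = g (cC m) + 2 * g (cD m) := by
  induction m using Nat.strong_induction_on with
  | _ m ih =>
    by_cases h : m = 0
    · subst h; simp [c_zero, hg0]
    · have := ih (m / 4) (by omega)
      rw [cC_eq, cD_eq, g_div g hge hgo _ _ (by omega), g_div g hge hgo _ _ (by omega)]
      omega

lemma code_g (g : ℕ → ℕ) (hg0 : g 0 = 0) (hge : ∀ n, g (2 * n) = 4 * g n)
    (hgo : ∀ n, g (2 * n + 1) = g (2 * n) + 1) (s : ℕ) : ∀ a b, a + b = s →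
    cC (g a + 2 * g b) = a ∧ cD (g a + 2 * g b) = b := by
  induction s using Nat.strong_induction_on with
  | _ s ih =>
    intro a b hab
    by_cases h : s = 0
    · obtain ⟨rfl, rfl⟩ : a = 0 ∧ b = 0 := by omega
      simp [hg0, c_zero]
    · have := ih (a / 2 + b / 2) (by omega) (a / 2) (b / 2) rfl
      have e1 : g a = 4 * g (a / 2) + a % 2 := by
        rw [← g_div g hge hgo _ _ (by omega)]; congr 1; omega
      have e2 : g b = 4 * g (b / 2) + b % 2 := by
        rw [← g_div g hge hgo _ _ (by omega)]; congr 1; omega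
      have e3 : g a + 2 * g b = 4 * (g (a / 2) + 2 * g (b / 2)) + (a % 2 + 2 * (b % 2)) := by
        omega
      rw [e3, cC_four _ _ (by omega), cD_four _ _ (by omega), this.1, this.2]
      omega

lemma rec_pow (α : ℕ → Polynomial (ZMod 2))
    (hrec : ∀ n, Odd n → α (n + 8) = X ^ 8 * α n + X ^ 2 * α (n + 2)) (k : ℕ) :
    ∀ n, Odd n → α (n + 8 * 2 ^ k) =
      X ^ (8 * 2 ^ k) * α n + X ^ (2 * 2 ^ k) * α (n + 2 * 2 ^ k) := by
  induction k with
  | zero => simpa using hrec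
  | succ k ih =>
    intro n hn
    rw [show 2 ^ (k + 1) = 2 * 2 ^ k by ring]
    generalize 2 ^ k = q at *
    have o1 : Odd (n + 8 * q) := hn.add_even ⟨4 * q, by ring⟩
    have o2 : Odd (n + 2 * q) := hn.add_even ⟨q, by ring⟩
    rw [show n + 8 * (2 * q) = n + 8 * q + 8 * q by ring, ih _ o1, ih _ hn,
      show n + 8 * q + 2 * q = n + 2 * q + 8 * q by ring, ih _ o2,
      show n + 2 * q + 2 * q = n + 2 * (2 * q) by ring]
    have h2 : ∀ p : Polynomial (ZMod 2), p + p = 0 := fun p => CharTwo.add_self_eq_zero p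
    have := h2 (X ^ (8 * q) * X ^ (2 * q) * α (n + 2 * q))
    rw [show 8 * (2 * q) = 8 * q + 8 * q by ring, show 2 * (2 * q) = 2 * q + 2 * q by ring,
      pow_add, pow_add]
    linear_combination this

lemma odd_supp (α : ℕ → Polynomial (ZMod 2))
    (h1 : α 1 = 0) (h3 : α 3 = X) (h5 : α 5 = 0) (h7 : α 7 = X ^ 5)
    (hrec : ∀ n, Odd n → α (n + 8) = X ^ 8 * α n + X ^ 2 * α (n + 2)) (n : ℕ) :
    Odd n → ∀ m, (α n).coeff m ≠ 0 → m % 2 = 1 := by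
  induction n using Nat.strong_induction_on with
  | _ n ih =>
    intro hn m hm
    by_cases h8 : n < 8
    · interval_cases n
      · exact absurd hn (by decide)
      · simp [h1] at hm
      · exact absurd hn (by decide)
      · rw [h3, coeff_X] at hm
        split_ifs at hm with h
        · omega
        · exact absurd rfl hm
      · exact absurd hn (by decide)
      · simp [h5] at hm
      · exact absurd hn (by decide)
      · rw [h7, coeff_X_pow] at hm
        split_ifs at hm with h
        · omega
        · exact absurd rfl hm
    · obtain ⟨n, rfl⟩ : ∃ n', n = n' + 8 := ⟨n - 8, by omega⟩
      have o : Odd n := by rw [Nat.odd_iff] at *; omega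
      have o' : Odd (n + 2) := by rw [Nat.odd_iff] at *; omega
      rw [hrec n o, coeff_add, coeff_X_pow_mul', coeff_X_pow_mul'] at hm
      rcases or_of_add hm with h | h
      · split_ifs at h
        · have := ih n (by omega) o _ h
          omega
        · exact absurd rfl h
      · split_ifs at h
        · have := ih (n + 2) (by omega) o' _ h
          omega
        · exact absurd rfl h

theorem stmt_14 (g : ℕ → ℕ) (hg0 : g 0 = 0)
    (hge : ∀ n, g (2 * n) = 4 * g n)
    (hgo : ∀ n, g (2 * n + 1) = g (2 * n) + 1)
    (α : ℕ → Polynomial (ZMod 2))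
    (h1 : α 1 = 0) (h3 : α 3 = X) (h5 : α 5 = 0) (h7 : α 7 = X ^ 5)
    (hrec : ∀ n, Odd n → α (n + 8) = X ^ 8 * α n + X ^ 2 * α (n + 2)) :
    ∀ n, Odd n → 0 < n → ∀ a b, n = 1 + 2 * g a + 4 * g b →
      (0 < a → ∃ B : Polynomial (ZMod 2),
        α n = X ^ (1 + 2 * g (a - 1) + 4 * g b) + B ∧
        ∀ m, B.coeff m ≠ 0 → ∃ c d, m = 1 + 2 * g c + 4 * g d ∧ prec c d (a - 1) b) ∧
      (a = 0 → ∀ m, (α n).coeff m ≠ 0 →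
        ∃ c d, m = 1 + 2 * g c + 4 * g d ∧ ((c, d) = (0, b - 1) ∨ prec c d 0 (b - 1))) := by
  have hgood : ∀ j, Good (fun j i => (α (2 * j + 1)).coeff (2 * i + 1)) j := by
    apply good_all
    · intro i; simp [h1]
    · intro i
      simp only [h3, coeff_X, show 2 * 1 + 1 = 3 by rfl]
      split_ifs with h
      · simp; omega
      · simp; omega
    · intro i; simp [h5]
    · intro i
      simp only [h7, coeff_X_pow, show 2 * 3 + 1 = 7 by rfl]
      split_ifs with h
      · simp; omega
      · simp; omega
    · intro k j i
      have := rec_pow α hrec k (2 * j + 1) ⟨j, rfl⟩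
      have e1 : 2 * (j + 4 * 2 ^ k) + 1 = 2 * j + 1 + 8 * 2 ^ k := by ring
      have e2 : 2 * (j + 2 ^ k) + 1 = 2 * j + 1 + 2 * 2 ^ k := by ring
      simp only [e1, e2, this, coeff_add, coeff_X_pow_mul']
      congr 1
      · by_cases h : 4 * 2 ^ k ≤ i
        · rw [if_pos h, if_pos (by omega)]; congr 1; omega
        · rw [if_neg h, if_neg (by omega)]
      · by_cases h : 2 ^ k ≤ i
        · rw [if_pos h, if_pos (by omega)]; congr 1; omega
        · rw [if_neg h, if_neg (by omega)]
  intro n hn _ a b hab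
  obtain ⟨j, rfl⟩ : ∃ j, n = 2 * j + 1 := hn
  have hj : j = g a + 2 * g b := by omega
  obtain ⟨ca, cb⟩ := code_g g hg0 hge hgo _ a b rfl
  rw [← hj] at ca cb
  obtain ⟨G1, G2⟩ := hgood j
  simp only [ca, cb] at G1 G2
  have hodd := odd_supp α h1 h3 h5 h7 hrec (2 * j + 1) ⟨j, rfl⟩
  have hcode := g_code g hg0 hge hgo
  constructor
  · intro ha
    obtain ⟨i, i1, i2, i3⟩ := G2 ha
    have hi := hcode i
    rw [i3, show cC i = a - 1 by omega] at hi
    refine ⟨α (2 * j + 1) - X ^ (1 + 2 * g (a - 1) + 4 * g b), by ring, ?_⟩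
    intro m hm
    rw [coeff_sub, coeff_X_pow] at hm
    have hmi : m ≠ 2 * i + 1 := by
      rintro rfl
      rw [if_pos (by omega)] at hm
      have : ∀ x : ZMod 2, x ≠ 0 → x - 1 = 0 := by decide
      exact hm (this _ i1)
    rw [if_neg (by omega), sub_zero] at hm
    have hm2 := hodd m hm
    obtain ⟨l, rfl⟩ : ∃ l, m = 2 * l + 1 := ⟨m / 2, by omega⟩
    have hl := hcode l
    obtain ⟨-, l1, l2⟩ := G1 l hm
    refine ⟨cC l, cD l, by omega, ?_⟩
    have hne : ¬ (cC l = a - 1 ∧ cD l = b) := by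
      rintro ⟨q1, q2⟩
      rw [q1, q2] at hl
      omega
    unfold prec
    omega
  · intro ha m hm
    have hm2 := hodd m hm
    obtain ⟨l, rfl⟩ : ∃ l, m = 2 * l + 1 := ⟨m / 2, by omega⟩
    have hl := hcode l
    obtain ⟨-, l1, l2⟩ := G1 l hm
    refine ⟨cC l, cD l, by omega, ?_⟩
    unfold prec
    rw [Prod.mk.injEq]
    omega
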